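/- In the Tracy–Widom setting with non-universal data, suppose equations (TW1), (TW2), (TW3), and (TW4) hold on Ω, with all q_k, p_k C¹ and v, T C². Then for every index j, at every point of Ω: ∂_j(𝓑_0 T) − a_j ∂_j(𝓓 T) = ∂_j v · (Y_j − X_j). -/

import Mathlib

noncomputable section

/-- Partial derivative in the `j`-th coordinate direction. -/
def pd {N : ℕ} (j : Fin N) (f : (Fin N → ℝ) → ℝ) : (Fin N → ℝ) → ℝ :=
  fun x => fderiv ℝ f x (Pi.single j 1)

/-- Virasoro-type operator `𝓑_k` (meaningful for `k ≥ -1`):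
`𝓑_k f = Σ_j a_j^(k+1) ∂_j f`. -/
def Bop {N : ℕ} (k : ℤ) (f : (Fin N → ℝ) → ℝ) : (Fin N → ℝ) → ℝ :=
  fun x => ∑ j, (x j) ^ (k + 1).toNat * pd j f x

/-- `𝓓 = 𝓑_{-1} = Σ_j ∂_j`. -/
def Dop {N : ℕ} (f : (Fin N → ℝ) → ℝ) : (Fin N → ℝ) → ℝ := Bop (-1) f

/-- `Ĝ_k = Σ_j a_j^k G_j` (meaningful for `k ≥ 0`). -/
def hatG {N : ℕ} (k : ℤ) (G : Fin N → (Fin N → ℝ) → ℝ) : (Fin N → ℝ) → ℝ :=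
  fun x => ∑ j, (x j) ^ k.toNat * G j x

/-- The Tracy–Widom resolvent quantity `R_{jk} = (q_j p_k - p_j q_k)/(a_j - a_k)`. -/
def Rjk {N : ℕ} (q p : Fin N → (Fin N → ℝ) → ℝ) (j k : Fin N) : (Fin N → ℝ) → ℝ :=
  fun x => (q j x * p k x - p j x * q k x) / (x j - x k)

lemma pd_line {N : ℕ} {f : (Fin N → ℝ) → ℝ} (j : Fin N) (x : Fin N → ℝ) (t : ℝ)
    (hf : DifferentiableAt ℝ f (x + t • Pi.single j (1:ℝ))) :
    HasDerivAt (fun s : ℝ => f (x + s • Pi.single j (1:ℝ))) (pd j f (x + t • Pi.single j (1:ℝ))) t := by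
  have h1 : HasDerivAt (fun s : ℝ => x + s • (Pi.single j (1:ℝ) : Fin N → ℝ)) (Pi.single j 1) t := by
    simpa using ((hasDerivAt_id t).smul_const (Pi.single j (1:ℝ) : Fin N → ℝ)).const_add x
  exact hf.hasFDerivAt.comp_hasDerivAt t h1

lemma pd_line0 {N : ℕ} {f : (Fin N → ℝ) → ℝ} (j : Fin N) (x : Fin N → ℝ)
    (hf : DifferentiableAt ℝ f x) :
    HasDerivAt (fun s : ℝ => f (x + s • Pi.single j (1:ℝ))) (pd j f x) 0 := by
  have := pd_line (f := f) j x 0 (by simpa using hf)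
  simpa using this

/-- Peano form of the symmetry of mixed partial derivatives. -/
lemma peano {N : ℕ} {Ω : Set (Fin N → ℝ)} (hΩ : IsOpen Ω) {f g : (Fin N → ℝ) → ℝ}
    (j k : Fin N) (hf : ∀ y ∈ Ω, DifferentiableAt ℝ f y) (hg : ContDiffOn ℝ 1 g Ω)
    (hfg : ∀ y ∈ Ω, pd j f y = g y) {x : Fin N → ℝ} (hx : x ∈ Ω) :
    HasDerivAt (fun s : ℝ => pd k f (x + s • Pi.single j (1:ℝ))) (pd k g x) 0 := by
  have hs : HasStrictFDerivAt g (fderiv ℝ g x) x :=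
    (hg.contDiffAt (hΩ.mem_nhds hx)).hasStrictFDerivAt (by norm_num)
  rw [hasDerivAt_iff_isLittleO, Asymptotics.isLittleO_iff]
  intro ε hε
  have h1 := (Asymptotics.isLittleO_iff.1 hs.isLittleO) hε
  rw [← Prod.mk.eta (p := (x, x))] at h1
  obtain ⟨r, hr, hb⟩ := Metric.eventually_nhds_iff.1 (h1)
  obtain ⟨r', hr', hb'⟩ := Metric.isOpen_iff.1 hΩ x hx
  set ρ := min r r' / 2 with hρ
  have hρ0 : 0 < ρ := by positivity
  set ej : Fin N → ℝ := Pi.single j 1 with hej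
  set ek : Fin N → ℝ := Pi.single k 1 with hek
  have nj : ‖ej‖ = 1 := by rw [hej, Pi.norm_single, norm_one]
  have nk : ‖ek‖ = 1 := by rw [hek, Pi.norm_single, norm_one]
  have near : ∀ s y : ℝ, |s| < ρ → |y| < ρ → dist (x + s • ej + y • ek) x < min r r' := by
    intro s y hs hy
    rw [dist_eq_norm]
    have : x + s • ej + y • ek - x = s • ej + y • ek := by abel
    rw [this]
    calc _ ≤ ‖s • ej‖ + ‖y • ek‖ := norm_add_le _ _
      _ = |s| + |y| := by simp [norm_smul, nj, nk]
      _ < min r r' := by rw [hρ] at hs hy; linarith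
  have inΩ : ∀ s y : ℝ, |s| < ρ → |y| < ρ → x + s • ej + y • ek ∈ Ω := fun s y hs hy =>
    hb' ((near s y hs hy).trans_le (min_le_right _ _))
  have key : ∀ s y : ℝ, |s| < ρ → |y| < ρ →
      ‖(f (x + s • ej + y • ek) - f (x + s • ej)) - (f (x + y • ek) - f x) - s * y * pd k g x‖
        ≤ ε * |y| * |s| := by
    intro s y hs hy
    have hz : |(0:ℝ)| < ρ := by simpa using hρ0
    have hder : ∀ t ∈ Metric.ball (0:ℝ) ρ, HasDerivWithinAt
        (fun t : ℝ => f (x + y • ek + t • ej) - f (x + t • ej) - t * (y * pd k g x))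
        (g (x + y • ek + t • ej) - g (x + t • ej) - y * pd k g x) (Metric.ball (0:ℝ) ρ) t := by
      intro t ht
      have ht' : |t| < ρ := by simpa using ht
      have m1 : x + y • ek + t • ej ∈ Ω := by
        have := inΩ t y ht' hy; rwa [add_right_comm] at this
      have m2 : x + t • ej ∈ Ω := by simpa using inΩ t 0 ht' hz
      have d1 := pd_line (f := f) j (x + y • ek) t (hf _ m1)
      have d2 := pd_line (f := f) j x t (hf _ m2)
      rw [hfg _ m1] at d1
      rw [hfg _ m2] at d2
      have d3 := (hasDerivAt_id t).mul_const (y * pd k g x)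
      have := (d1.sub d2).sub d3
      simp only [one_mul] at this
      exact this.hasDerivWithinAt
    have hbd : ∀ t ∈ Metric.ball (0:ℝ) ρ,
        ‖g (x + y • ek + t • ej) - g (x + t • ej) - y * pd k g x‖ ≤ ε * |y| := by
      intro t ht
      have ht' : |t| < ρ := by simpa using ht
      have n1 := near t y ht' hy
      have n2 := near t 0 ht' hz
      rw [add_right_comm] at n1
      simp only [zero_smul, add_zero] at n2
      have := @hb (x + y • ek + t • ej, x + t • ej) (by
        rw [Prod.dist_eq]
        exact max_lt (n1.trans_le (min_le_left _ _)) (n2.trans_le (min_le_left _ _)))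
      have e : x + y • ek + t • ej - (x + t • ej) = y • ek := by abel
      simp only [e, map_smul, norm_smul, nk, smul_eq_mul, mul_one] at this
      exact this
    have := (convex_ball (0:ℝ) ρ).norm_image_sub_le_of_norm_hasDerivWithin_le hder hbd
      (Metric.mem_ball_self hρ0) (show s ∈ Metric.ball (0:ℝ) ρ by simpa using hs)
    simp only [zero_smul, add_zero, zero_mul, sub_zero, Real.norm_eq_abs] at this
    rw [add_right_comm x (y • ek)] at this
    rw [Real.norm_eq_abs]
    convert this using 2
    ring
  have hev : ∀ᶠ s : ℝ in nhds 0, |s| < ρ := by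
    filter_upwards [Metric.ball_mem_nhds (0:ℝ) hρ0] with s hs
    simpa using hs
  filter_upwards [hev] with s hs
  have hz : |(0:ℝ)| < ρ := by simpa using hρ0
  have m1 : x + s • ej ∈ Ω := by simpa using inΩ s 0 hs hz
  have d1 := pd_line0 k (x + s • ej) (hf _ m1)
  have d2 := pd_line0 k x (hf _ hx)
  have d := (d1.sub d2).sub ((hasDerivAt_id (0:ℝ)).mul_const (s * pd k g x))
  have lim := (hasDerivAt_iff_tendsto_slope.1 d).norm
  simp only [zero_smul, add_zero, sub_zero, smul_eq_mul]
  rw [one_mul] at lim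
  refine le_of_tendsto lim ?_
  have hev' := hev.filter_mono (nhdsWithin_le_nhds (s := {(0:ℝ)}ᶜ))
  filter_upwards [hev', self_mem_nhdsWithin] with y hy hy0
  have hy0 : y ≠ 0 := hy0
  have kk := key s y hs hy
  rw [slope_def_field, norm_div, div_le_iff₀ (by simpa using hy0)]
  simp only [Pi.sub_apply, zero_smul, add_zero, sub_zero, id, zero_mul]
  calc _ = _ := by congr 1; ring
    _ ≤ _ := kk
    _ = _ := by simp only [Real.norm_eq_abs]; ring

theorem statement7 {N : ℕ} (hN : 2 ≤ N) (Ω : Set (Fin N → ℝ)) (hΩ : IsOpen Ω)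
    (hdist : ∀ x ∈ Ω, ∀ j l : Fin N, j ≠ l → x j ≠ x l)
    (u v w T : (Fin N → ℝ) → ℝ) (q p X Y : Fin N → (Fin N → ℝ) → ℝ)
    (hq : ∀ i, ContDiffOn ℝ 1 (q i) Ω) (hp : ∀ i, ContDiffOn ℝ 1 (p i) Ω)
    (hv : ContDiffOn ℝ 2 v Ω) (hT : ContDiffOn ℝ 2 T Ω)
    (hTW1q : ∀ (i k : Fin N), i ≠ k → ∀ x ∈ Ω,
      pd k (q i) x = (-1 : ℝ) ^ (k : ℕ) * Rjk q p i k x * q k x)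
    (hTW1p : ∀ (i k : Fin N), i ≠ k → ∀ x ∈ Ω,
      pd k (p i) x = (-1 : ℝ) ^ (k : ℕ) * Rjk q p i k x * p k x)
    (hTW2u : ∀ (i : Fin N), ∀ x ∈ Ω, pd i u x = (-1 : ℝ) ^ (i : ℕ) * (q i x) ^ 2)
    (hTW2v : ∀ (i : Fin N), ∀ x ∈ Ω, pd i v x = (-1 : ℝ) ^ (i : ℕ) * (q i x * p i x))
    (hTW2w : ∀ (i : Fin N), ∀ x ∈ Ω, pd i w x = (-1 : ℝ) ^ (i : ℕ) * (p i x) ^ 2)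
    (hTW3 : ∀ (i : Fin N), ∀ x ∈ Ω,
      (-1 : ℝ) ^ ((i : ℕ) + 1) * pd i T x = p i x * pd i (q i) x - q i x * pd i (p i) x)
    (hTW4q : ∀ (i : Fin N), ∀ x ∈ Ω,
      pd i (q i) x = q i x * X i x
        - ∑ k ∈ Finset.univ.erase i, (-1 : ℝ) ^ (k : ℕ) * Rjk q p i k x * q k x)
    (hTW4p : ∀ (i : Fin N), ∀ x ∈ Ω,
      pd i (p i) x = p i x * Y i x
        - ∑ k ∈ Finset.univ.erase i, (-1 : ℝ) ^ (k : ℕ) * Rjk q p i k x * p k x) :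
    ∀ (j : Fin N), ∀ x ∈ Ω,
      pd j (Bop 0 T) x - x j * pd j (Dop T) x = pd j v x * (Y j x - X j x) := by
  intro j x hx
  have dq : ∀ i, ∀ y ∈ Ω, DifferentiableAt ℝ (q i) y := fun i y hy =>
    ((hq i).contDiffAt (hΩ.mem_nhds hy)).differentiableAt (by norm_num)
  have dp : ∀ i, ∀ y ∈ Ω, DifferentiableAt ℝ (p i) y := fun i y hy =>
    ((hp i).contDiffAt (hΩ.mem_nhds hy)).differentiableAt (by norm_num)
  have dT : ∀ k, DifferentiableAt ℝ (pd k T) x := by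
    intro k
    have h1 : ContDiffAt ℝ 1 (fderiv ℝ T) x :=
      (hT.contDiffAt (hΩ.mem_nhds hx)).fderiv_right (by norm_num)
    exact (h1.differentiableAt (by norm_num)).clm_apply (differentiableAt_const _)
  have sq : ∀ k : Fin N, (-1:ℝ) ^ (k:ℕ) * (-1:ℝ) ^ (k:ℕ) = 1 := by
    intro k; rw [← mul_pow]; simp
  have pT : ∀ k, ∀ y ∈ Ω, pd k T y
      = -(-1:ℝ)^(k:ℕ) * (p k y * pd k (q k) y - q k y * pd k (p k) y) := by
    intro k y hy
    rw [← hTW3 k y hy, pow_succ]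
    linear_combination (-pd k T y) * sq k
  have mixed : ∀ k, k ≠ j → pd j (pd k T) x
      = -((-1:ℝ)^(j:ℕ) * (-1:ℝ)^(k:ℕ) * (Rjk q p j k x)^2) := by
    intro k hkj
    have cR : ContDiffOn ℝ 1 (Rjk q p k j) Ω := by
      refine ContDiffOn.div (((hq k).mul (hp j)).sub ((hp k).mul (hq j))) ?_ ?_
      · fun_prop
      · intro y hy; exact sub_ne_zero.2 (hdist y hy k j hkj)
    have dR : DifferentiableAt ℝ (Rjk q p k j) x :=
      (cR.contDiffAt (hΩ.mem_nhds hx)).differentiableAt (by norm_num)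
    have Pq := peano hΩ j k (dq k) ((contDiffOn_const.mul cR).mul (hq j))
      (hTW1q k j hkj) hx
    have Pp := peano hΩ j k (dp k) ((contDiffOn_const.mul cR).mul (hp j))
      (hTW1p k j hkj) hx
    -- compute pd k of the right sides
    have lR := pd_line0 k x dR
    have gq : pd k (fun y => (-1:ℝ)^(j:ℕ) * Rjk q p k j y * q j y) x
        = (-1:ℝ)^(j:ℕ) * (pd k (Rjk q p k j) x * q j x + Rjk q p k j x * pd k (q j) x) := by
      have a := pd_line0 k x (((dR.const_mul ((-1:ℝ)^(j:ℕ))).mul (dq j x hx)))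
      have b := (lR.const_mul ((-1:ℝ)^(j:ℕ))).mul (pd_line0 k x (dq j x hx))
      have c := a.unique b
      simp only [zero_smul, add_zero] at c
      refine Eq.trans c ?_
      ring
    have gp : pd k (fun y => (-1:ℝ)^(j:ℕ) * Rjk q p k j y * p j y) x
        = (-1:ℝ)^(j:ℕ) * (pd k (Rjk q p k j) x * p j x + Rjk q p k j x * pd k (p j) x) := by
      have a := pd_line0 k x (((dR.const_mul ((-1:ℝ)^(j:ℕ))).mul (dp j x hx)))
      have b := (lR.const_mul ((-1:ℝ)^(j:ℕ))).mul (pd_line0 k x (dp j x hx))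
      have c := a.unique b
      simp only [zero_smul, add_zero] at c
      refine Eq.trans c ?_
      ring
    have lineΩ : ∀ i : Fin N, ∀ᶠ s : ℝ in nhds 0, x + s • (Pi.single i (1:ℝ) : Fin N → ℝ) ∈ Ω := by
      intro i
      have : ContinuousAt (fun s : ℝ => x + s • (Pi.single i (1:ℝ) : Fin N → ℝ)) 0 := by fun_prop
      exact this.eventually_mem (hΩ.mem_nhds (by simpa using hx))
    have Rrel : ∀ y ∈ Ω, Rjk q p k j y * (y k - y j) = q k y * p j y - p k y * q j y := by
      intro y hy
      exact div_mul_cancel₀ _ (sub_ne_zero.2 (hdist y hy k j hkj))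
    have relx := Rrel x hx
    have relder : pd k (Rjk q p k j) x * (x k - x j) + Rjk q p k j x
        = (pd k (q k) x * p j x + q k x * pd k (p j) x)
          - (pd k (p k) x * q j x + p k x * pd k (q j) x) := by
      have l0 : HasDerivAt (fun s : ℝ => (x + s • (Pi.single k (1:ℝ) : Fin N → ℝ)) k
          - (x + s • (Pi.single k (1:ℝ) : Fin N → ℝ)) j) 1 0 := by
        simp only [Pi.add_apply, Pi.smul_apply, Pi.single_eq_same,
          Pi.single_eq_of_ne (Ne.symm hkj), smul_eq_mul, mul_one, mul_zero, add_zero]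
        exact ((hasDerivAt_id (0:ℝ)).const_add _).sub_const _
      have a := lR.mul l0
      have b := ((pd_line0 k x (dq k x hx)).mul (pd_line0 k x (dp j x hx))).sub
        ((pd_line0 k x (dp k x hx)).mul (pd_line0 k x (dq j x hx)))
      have c := b.congr_of_eventuallyEq
        (f₁ := (fun s : ℝ => Rjk q p k j (x + s • (Pi.single k (1:ℝ) : Fin N → ℝ))) *
          (fun s : ℝ => (x + s • (Pi.single k (1:ℝ) : Fin N → ℝ)) k
          - (x + s • (Pi.single k (1:ℝ) : Fin N → ℝ)) j)) (by
          filter_upwards [lineΩ k] with s hs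
          exact Rrel _ hs)
      have d := a.unique c
      simpa using d
    have lT := pd_line0 j x (dT k)
    have rT := (((pd_line0 j x (dp k x hx)).mul Pq).sub
      ((pd_line0 j x (dq k x hx)).mul Pp)).const_mul (-(-1:ℝ)^(k:ℕ))
    have rT' := rT.congr_of_eventuallyEq
      (f₁ := fun s : ℝ => pd k T (x + s • (Pi.single j (1:ℝ) : Fin N → ℝ))) (by
        filter_upwards [lineΩ j] with s hs
        exact pT k _ hs)
    have e := lT.unique rT'
    rw [gq, gp] at e
    simp only [zero_smul, add_zero] at e
    rw [hTW1q k j hkj x hx, hTW1p k j hkj x hx] at e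
    have symR : Rjk q p j k x = Rjk q p k j x := by
      unfold Rjk
      rw [← neg_sub (x k) (x j), div_neg, ← neg_div]; congr 1; ring
    rw [hTW1q j k hkj.symm x hx, hTW1p j k hkj.symm x hx, symR] at *
    rw [e]
    generalize Rjk q p k j x = R at *
    generalize pd k (Rjk q p k j) x = R' at *
    generalize pd k (q k) x = a at *
    generalize pd k (p k) x = b at *
    generalize (-1:ℝ)^(j:ℕ) = ej at *
    generalize (-1:ℝ)^(k:ℕ) = ek at *
    linear_combination (ej * ek * R) * relder - (ej * ek * R') * relx
  have B0 : pd j (Bop 0 T) x = pd j T x + ∑ k, x k * pd j (pd k T) x := by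
    have hB : DifferentiableAt ℝ (Bop 0 T) x := by
      unfold Bop
      refine DifferentiableAt.fun_sum fun i _ => DifferentiableAt.mul ?_ (dT i)
      fun_prop
    have a := pd_line0 j x hB
    have b : HasDerivAt (fun s : ℝ => ∑ k, (x + s • (Pi.single j (1:ℝ) : Fin N → ℝ)) k *
        pd k T (x + s • (Pi.single j (1:ℝ) : Fin N → ℝ)))
        (∑ k, ((Pi.single j (1:ℝ) : Fin N → ℝ) k * pd k T x + x k * pd j (pd k T) x)) 0 := by
      refine HasDerivAt.fun_sum fun k _ => ?_
      have l0 : HasDerivAt (fun s : ℝ => (x + s • (Pi.single j (1:ℝ) : Fin N → ℝ)) k)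
          ((Pi.single j (1:ℝ) : Fin N → ℝ) k) 0 := by
        simpa using ((hasDerivAt_id (0:ℝ)).mul_const
          ((Pi.single j (1:ℝ) : Fin N → ℝ) k)).const_add (x k)
      have l1 := l0.mul (pd_line0 j x (dT k))
      simp only [zero_smul, add_zero] at l1
      exact l1
    have c := a.unique (by simpa [Bop] using b)
    rw [c, Finset.sum_add_distrib]
    simp [Pi.single_apply]
  have D0 : pd j (Dop T) x = ∑ k, pd j (pd k T) x := by
    have hB : DifferentiableAt ℝ (Dop T) x := by
      unfold Dop Bop
      refine DifferentiableAt.fun_sum fun i _ => DifferentiableAt.mul ?_ (dT i)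
      fun_prop
    have a := pd_line0 j x hB
    have b : HasDerivAt (fun s : ℝ => ∑ k,
        pd k T (x + s • (Pi.single j (1:ℝ) : Fin N → ℝ)))
        (∑ k, pd j (pd k T) x) 0 :=
      HasDerivAt.fun_sum fun k _ => pd_line0 j x (dT k)
    exact a.unique (by simpa [Dop, Bop] using b)
  have S : ∑ k, x k * pd j (pd k T) x - x j * ∑ k, pd j (pd k T) x
      = ∑ k ∈ Finset.univ.erase j, (x k - x j) *
        (-((-1:ℝ)^(j:ℕ) * (-1:ℝ)^(k:ℕ) * (Rjk q p j k x)^2)) := by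
    rw [Finset.mul_sum, ← Finset.sum_sub_distrib, ← Finset.add_sum_erase _ _ (Finset.mem_univ j)]
    rw [sub_self, zero_add]
    refine Finset.sum_congr rfl fun k hk => ?_
    rw [mixed k (Finset.ne_of_mem_erase hk)]; ring
  have S2 : p j x * (∑ k ∈ Finset.univ.erase j, (-1 : ℝ) ^ (k : ℕ) * Rjk q p j k x * q k x)
      - q j x * (∑ k ∈ Finset.univ.erase j, (-1 : ℝ) ^ (k : ℕ) * Rjk q p j k x * p k x)
      = -(-1:ℝ)^(j:ℕ) * ∑ k ∈ Finset.univ.erase j, (x k - x j) *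
        (-((-1:ℝ)^(j:ℕ) * (-1:ℝ)^(k:ℕ) * (Rjk q p j k x)^2)) := by
    rw [Finset.mul_sum, Finset.mul_sum, Finset.mul_sum, ← Finset.sum_sub_distrib]
    refine Finset.sum_congr rfl fun k hk => ?_
    have r : Rjk q p j k x * (x j - x k) = q j x * p k x - p j x * q k x :=
      div_mul_cancel₀ _ (sub_ne_zero.2 (hdist x hx j k (Finset.ne_of_mem_erase hk).symm))
    linear_combination ((-1:ℝ)^(k:ℕ) * Rjk q p j k x) * r
      - ((x k - x j) * (-1:ℝ)^(k:ℕ) * (Rjk q p j k x)^2) * sq j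
  rw [B0, D0, pT j x hx, hTW4q j x hx, hTW4p j x hx, hTW2v j x hx]
  linear_combination S + (-1:ℝ)^(j:ℕ) * S2 - (∑ k ∈ Finset.univ.erase j, (x k - x j) *
        (-((-1:ℝ)^(j:ℕ) * (-1:ℝ)^(k:ℕ) * (Rjk q p j k x)^2))) * sq j
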